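/- Let k ≥ 4, let B be a finite simple graph on a nonempty vertex set V, and let G be the join of B with the complete graph on k−3 vertices. If there exists a proper 3-coloring of B that cannot be transformed (within proper 3-colorings of B) into a proper 3-coloring using at most 2 distinct colors, then G is not k-mixing. -/

import Mathlib

/-- A proper `k`-coloring of `G`: adjacent vertices receive distinct colors. -/
def Proper {V : Type*} (G : SimpleGraph V) (k : ℕ) (c : V → Fin k) : Prop :=
  ∀ ⦃u v : V⦄, G.Adj u v → c u ≠ c v

/-- Two proper `k`-colorings are adjacent if they differ on exactly one vertex. -/
def ColAdj {V : Type*} (G : SimpleGraph V) (k : ℕ) (c c' : V → Fin k) : Prop :=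
  Proper G k c ∧ Proper G k c' ∧ ∃! v, c v ≠ c' v

/-- `c` can be transformed into `c'` via single-vertex recolorings through
proper `k`-colorings. -/
def Reach {V : Type*} (G : SimpleGraph V) (k : ℕ) : (V → Fin k) → (V → Fin k) → Prop :=
  Relation.ReflTransGen (ColAdj G k)

/-- `G` is `k`-mixing: any proper `k`-coloring can be transformed into any other. -/
def Mixing {V : Type*} (G : SimpleGraph V) (k : ℕ) : Prop :=
  ∀ c c' : V → Fin k, Proper G k c → Proper G k c' → Reach G k c c'

/-- `G` is bipartite: it admits a proper `2`-coloring. -/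
def Bipartite {V : Type*} (G : SimpleGraph V) : Prop :=
  ∃ c : V → Fin 2, Proper G 2 c

/-- The join of `B` with the complete graph on `m` vertices. -/
def JoinK {V : Type*} (B : SimpleGraph V) (m : ℕ) : SimpleGraph (V ⊕ Fin m) :=
  SimpleGraph.fromRel fun x y =>
    match x, y with
    | Sum.inl u, Sum.inl v => B.Adj u v
    | Sum.inl _, Sum.inr _ => True
    | Sum.inr _, Sum.inl _ => True
    | Sum.inr i, Sum.inr j => i ≠ j

theorem joinK_adj_inl_inl {V : Type*} {B : SimpleGraph V} {m : ℕ} {u v : V} :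
    (JoinK B m).Adj (Sum.inl u) (Sum.inl v) ↔ B.Adj u v := by
  simp only [JoinK, SimpleGraph.fromRel_adj]
  exact ⟨fun h => h.2.elim id fun h => h.symm, fun h => ⟨by simpa using h.ne, Or.inl h⟩⟩

theorem joinK_adj_inl_inr {V : Type*} (B : SimpleGraph V) {m : ℕ} (u : V) (i : Fin m) :
    (JoinK B m).Adj (Sum.inl u) (Sum.inr i) := by
  simp [JoinK]

theorem joinK_adj_inr_inr {V : Type*} (B : SimpleGraph V) {m : ℕ} {i j : Fin m} :
    (JoinK B m).Adj (Sum.inr i) (Sum.inr j) ↔ i ≠ j := by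
  simp only [JoinK, SimpleGraph.fromRel_adj]
  exact ⟨fun h => h.2.elim id Ne.symm, fun h => ⟨by simpa using h, Or.inl h⟩⟩

/-- The coloring `d` of `JoinK B m` is `c` on `B` and colors the clique by `3, 4, …`. -/
def Extends {V : Type*} {m k : ℕ} (c : V → Fin 3) (d : V ⊕ Fin m → Fin k) : Prop :=
  (∀ u, (d (Sum.inl u) : ℕ) = c u) ∧ ∀ i, (d (Sum.inr i) : ℕ) = 3 + i

theorem Extends.proper_iff {V : Type*} {B : SimpleGraph V} {m k : ℕ} {c : V → Fin 3}
    {d : V ⊕ Fin m → Fin k} (h : Extends c d) : Proper (JoinK B m) k d ↔ Proper B 3 c := by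
  constructor
  · intro hd u v huv e
    exact hd (joinK_adj_inl_inl.2 huv) (Fin.ext (by rw [h.1, h.1, e]))
  · rintro hc (u | i) (v | j) hadj e
    · refine hc (joinK_adj_inl_inl.1 hadj) (Fin.ext ?_)
      rw [← h.1, ← h.1, e]
    · have := congrArg Fin.val e
      rw [h.1, h.2] at this
      omega
    · have := congrArg Fin.val e
      rw [h.1, h.2] at this
      omega
    · have := congrArg Fin.val e
      rw [h.2, h.2] at this
      exact (joinK_adj_inr_inr B).1 hadj (Fin.ext (by omega))

theorem ncard_range_le_two {V : Type*} {c : V → Fin 3} {x : Fin 3} (hx : ∀ u, c u ≠ x) :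
    (Set.range c).ncard ≤ 2 := by
  have hsub : Set.range c ⊆ (({x}ᶜ : Finset (Fin 3)) : Set (Fin 3)) := by
    rintro _ ⟨u, rfl⟩
    simpa using hx u
  refine (Set.ncard_le_ncard hsub (Finset.finite_toSet _)).trans ?_
  rw [Set.ncard_coe_finset, Finset.card_compl]
  simp

/-- If `c` uses all three colors, then a recoloring of an extension of `c` to the join
only recolors a vertex of `B`. -/
theorem Extends.step {V : Type*} {B : SimpleGraph V} {m k : ℕ} (hk : k = m + 3)
    {c : V → Fin 3} {d d' : V ⊕ Fin m → Fin k} (h : Extends c d)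
    (hc : ¬ (Set.range c).ncard ≤ 2) (hstep : ColAdj (JoinK B m) k d d') :
    ∃ c', Extends c' d' ∧ ColAdj B 3 c c' := by
  obtain ⟨hd, hd', v, hv, huniq⟩ := hstep
  have heq : ∀ w, w ≠ v → d w = d' w := fun w hw => by
    by_contra hne
    exact hw (huniq w hne)
  obtain v | i := v
  · have hr : ∀ i, (d' (Sum.inr i) : ℕ) = 3 + i := fun i => by
      rw [← heq _ (by simp), h.2]
    have hlt : ∀ u, (d' (Sum.inl u) : ℕ) < 3 := fun u => by
      by_contra hge
      have := (d' (Sum.inl u)).isLt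
      refine hd' (joinK_adj_inl_inr B u ⟨(d' (Sum.inl u) : ℕ) - 3, by omega⟩) (Fin.ext ?_)
      rw [hr]
      simp only
      omega
    have hext : Extends (fun u => ⟨d' (Sum.inl u), hlt u⟩) d' := ⟨fun _ => rfl, hr⟩
    refine ⟨_, hext, h.proper_iff.1 hd, hext.proper_iff.1 hd', v, ?_, fun u hu => ?_⟩
    · intro e
      exact hv (Fin.ext (by rw [h.1, e]))
    · refine Sum.inl_injective (huniq _ fun e => hu (Fin.ext ?_))
      rw [← h.1, e]
  · exfalso
    have hlt : (d' (Sum.inr i) : ℕ) < 3 := by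
      by_contra hge
      have := (d' (Sum.inr i)).isLt
      set j : Fin m := ⟨(d' (Sum.inr i) : ℕ) - 3, by omega⟩
      have hjv : (j : ℕ) = (d' (Sum.inr i) : ℕ) - 3 := rfl
      by_cases hij : i = j
      · refine hv (Fin.ext ?_)
        rw [h.2, hij, hjv, ← hij]
        omega
      · refine hd' ((joinK_adj_inr_inr B).2 hij) (Fin.ext ?_)
        rw [← heq (Sum.inr j) (by simpa using Ne.symm hij), h.2]
        omega
    refine hc (ncard_range_le_two (x := ⟨_, hlt⟩) fun u e => ?_)
    refine hd' (joinK_adj_inl_inr B u i) (Fin.ext ?_)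
    rw [← heq _ (by simp), h.1, e]

theorem Extends.of_reach {V : Type*} {B : SimpleGraph V} {m k : ℕ} (hk : k = m + 3)
    {c : V → Fin 3} {d d' : V ⊕ Fin m → Fin k} (h : Extends c d)
    (hc : ¬ ∃ c', Reach B 3 c c' ∧ (Set.range c').ncard ≤ 2)
    (hr : Reach (JoinK B m) k d d') : ∃ c', Extends c' d' ∧ Reach B 3 c c' := by
  induction hr with
  | refl => exact ⟨c, h, .refl⟩
  | tail _ hstep ih =>
    obtain ⟨c₁, h₁, hr₁⟩ := ih
    obtain ⟨c₂, h₂, hs⟩ := h₁.step hk (fun hle => hc ⟨c₁, hr₁, hle⟩) hstep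
    exact ⟨c₂, h₂, hr₁.tail hs⟩

/-- if some proper `3`-coloring of `B` cannot reach a coloring with
at most `2` colors, then the join of `B` with `K_{k-3}` is not `k`-mixing. -/
theorem stmt6 {V : Type*} [Fintype V] [Nonempty V] (k : ℕ) (hk : 4 ≤ k)
    (B : SimpleGraph V)
    (h : ∃ c : V → Fin 3, Proper B 3 c ∧
      ¬ ∃ c' : V → Fin 3, Reach B 3 c c' ∧ (Set.range c').ncard ≤ 2) :
    ¬ Mixing (JoinK B (k - 3)) k := by
  obtain ⟨c, hc, hno⟩ := h
  intro hmix
  let d : V ⊕ Fin (k - 3) → Fin k :=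
    Sum.elim (fun u => ⟨c u, by omega⟩) (fun i => ⟨3 + i, by omega⟩)
  have hext : Extends c d := ⟨fun _ => rfl, fun _ => rfl⟩
  have hd : Proper (JoinK B (k - 3)) k d := hext.proper_iff.2 hc
  let σ : Equiv.Perm (Fin k) := Equiv.swap ⟨3, by omega⟩ ⟨0, by omega⟩
  have hσ : Proper (JoinK B (k - 3)) k (σ ∘ d) := fun _ _ hadj => σ.injective.ne (hd hadj)
  obtain ⟨c', hc', -⟩ := hext.of_reach (by omega) hno (hmix d (σ ∘ d) hd hσ)
  have hz := hc'.2 ⟨0, by omega⟩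
  simp [d, σ] at hz
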